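/- Let e be a properly infinite projection in an AW*-algebra A and let f be a projection in A. (i) If f ≼ e, then e ∨ f ∼ e. (ii) If f is finite and c(f) ≤ c(e), then e ∨ f ∼ e. -/

import Mathlib

universe u

section Defs

variable {R : Type u} [Ring R] [StarRing R]

/-- An element is a projection if it is self-adjoint and idempotent. -/
def IsProjection (p : R) : Prop := star p = p ∧ p * p = p

/-- Order on projections: `e ≤ f` iff `e = ef`. -/
def ProjLE (e f : R) : Prop := e * f = e

/-- Murray–von Neumann equivalence of projections. -/
def ProjEquiv (e f : R) : Prop := ∃ v : R, star v * v = e ∧ v * star v = f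

/-- `e ≼ f` : `e` is equivalent to a subprojection of `f`. -/
def ProjSubEquiv (e f : R) : Prop :=
  ∃ e' : R, IsProjection e' ∧ ProjLE e' f ∧ ProjEquiv e e'

/-- `e ≺ f` : `e ≼ f` but `e` is not equivalent to `f` (with the convention `0 ≺ 0`). -/
def ProjLT (e f : R) : Prop :=
  (ProjSubEquiv e f ∧ ¬ ProjEquiv e f) ∨ (e = 0 ∧ f = 0)

/-- A central projection. -/
def IsCentralProj (z : R) : Prop := IsProjection z ∧ ∀ a : R, z * a = a * z

/-- `c` is the central cover of `e`: the least central projection above `e`. -/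
def IsCentralCover (e c : R) : Prop :=
  IsCentralProj c ∧ ProjLE e c ∧
    ∀ z : R, IsCentralProj z → ProjLE e z → ProjLE c z

/-- A projection `e` is finite if `e ∼ f ≤ e` implies `f = e`. -/
def ProjFinite (e : R) : Prop :=
  ∀ f : R, IsProjection f → ProjEquiv e f → ProjLE f e → f = e

/-- A nonzero projection is properly infinite if `ze` is infinite
for every central projection `z` with `ze ≠ 0`. -/
def ProperlyInfinite (e : R) : Prop :=
  IsProjection e ∧ e ≠ 0 ∧
    ∀ z : R, IsCentralProj z → z * e ≠ 0 → ¬ ProjFinite (z * e)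

/-- A pairwise orthogonal family of elements. -/
def PairwiseOrthogonal {ι : Type*} (p : ι → R) : Prop :=
  ∀ i j, i ≠ j → p i * p j = 0

/-- `s` is the supremum of the family `p` in the projection order. For an
orthogonal family, this is the sum `Σ pᵢ`. -/
def IsSupProj {ι : Type*} (p : ι → R) (s : R) : Prop :=
  IsProjection s ∧ (∀ i, ProjLE (p i) s) ∧
    ∀ t : R, IsProjection t → (∀ i, ProjLE (p i) t) → ProjLE s t

/-- The family `p` belongs to `Γ(e)`: an orthogonal family of projections,
each equivalent to `e`, with sum (supremum) `e`. -/
def InGamma (e : R) {ι : Type u} (p : ι → R) : Prop :=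
  (∀ i, IsProjection (p i)) ∧ PairwiseOrthogonal p ∧
    (∀ i, ProjEquiv (p i) e) ∧ IsSupProj p e

open Classical in
/-- The dimension `d(e)` of a properly infinite projection: the least cardinal
strictly greater than the cardinality of the index set of every family in
`Γ(e)`, with the convention `d(0) = 0`. -/
noncomputable def projDim (e : R) : Cardinal.{u} :=
  if e = 0 then 0
  else sSup {c : Cardinal.{u} |
    ∃ (ι : Type u) (p : ι → R), InGamma e p ∧ c = Order.succ (Cardinal.mk ι)}

/-- A properly infinite projection `e` is equidimensional if `d(ze) = d(e)`
for every central projection `z` with `ze ≠ 0` (equivalently, for every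
nonzero central projection `z ≤ c(e)`). -/
def Equidimensional (e : R) : Prop :=
  ProperlyInfinite e ∧
    ∀ z : R, IsCentralProj z → z * e ≠ 0 → projDim (z * e) = projDim e

/-- An abelian projection: the corner `eRe` is commutative. -/
def IsAbelianProj (e : R) : Prop :=
  IsProjection e ∧ ∀ a b : R, (e * a * e) * (e * b * e) = (e * b * e) * (e * a * e)

/-- `j` is the join `e ∨ f` in the projection lattice. -/
def IsJoinProj (e f j : R) : Prop :=
  IsProjection j ∧ ProjLE e j ∧ ProjLE f j ∧
    ∀ t : R, IsProjection t → ProjLE e t → ProjLE f t → ProjLE j t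

end Defs

/-- The AW*-condition: the right annihilator of any subset is generated by a
projection: `{a | ∀ s ∈ S, s a = 0} = pR`. -/
def IsAWStarRing (R : Type*) [Ring R] [StarRing R] : Prop :=
  ∀ S : Set R, ∃ p : R, IsProjection p ∧
    {a : R | ∀ s ∈ S, s * a = 0} = {a : R | ∃ b : R, a = p * b}

/-- A maximal abelian (*-sub)algebra. -/
def IsMaximalAbelian {A : Type*} [Ring A] [StarRing A] [Algebra ℂ A] [StarModule ℂ A]
    (M : StarSubalgebra ℂ A) : Prop :=
  (∀ x ∈ M, ∀ y ∈ M, x * y = y * x) ∧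
    ∀ N : StarSubalgebra ℂ A, (∀ x ∈ N, ∀ y ∈ N, x * y = y * x) → M ≤ N → M = N

section Helpers

variable {R : Type u} [Ring R] [StarRing R]

theorem IsProjection.star_eq {p : R} (h : IsProjection p) : star p = p := h.1
theorem IsProjection.idem {p : R} (h : IsProjection p) : p * p = p := h.2

/-- `r` is the support of a family -/
def IsS {ι : Type*} (p : ι → R) (r : R) : Prop :=
  IsProjection r ∧ ∀ y, (∀ i, p i * y = 0) ↔ r * y = 0

theorem aw_set (hAW : IsAWStarRing R) {ι : Type*} (p : ι → R) : ∃ r, IsS p r := by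
  obtain ⟨q, hq, h⟩ := hAW (Set.range p)
  have h' : ∀ y, (∀ i, p i * y = 0) ↔ ∃ b, y = q * b := by
    intro y
    have := Set.ext_iff.1 h y
    simpa using this
  refine ⟨1 - q, ⟨by simp [hq.1], by simp [mul_sub, sub_mul, hq.2]⟩, fun y => ?_⟩
  rw [h' y]
  constructor
  · rintro ⟨b, rfl⟩
    rw [sub_mul, ← mul_assoc q, hq.2, one_mul, sub_self]
  · intro hy
    refine ⟨y, ?_⟩
    rw [sub_mul, one_mul] at hy
    exact sub_eq_zero.1 hy

theorem aw_one (hAW : IsAWStarRing R) (x : R) :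
    ∃ r, IsProjection r ∧ ∀ y, x * y = 0 ↔ r * y = 0 := by
  obtain ⟨r, hr, h⟩ := aw_set hAW (fun _ : Unit => x)
  exact ⟨r, hr, fun y => by simpa using h y⟩

theorem aw_proper (hAW : IsAWStarRing R) (x : R) (hx : star x * x = 0) : x = 0 := by
  obtain ⟨r, hr, h⟩ := aw_one hAW (star x)
  have h1 : r * x = 0 := (h x).1 hx
  have h2 : star x * (1 - r) = 0 := (h _).2 (by rw [mul_sub, hr.2, mul_one, sub_self])
  have h3 : (1 - r) * x = 0 := by
    have := congrArg star h2
    simpa [hr.1] using this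
  rw [sub_mul, h1, one_mul, sub_zero] at h3
  exact h3

theorem aw_pi (hAW : IsAWStarRing R) {v p : R} (hp : IsProjection p) (hv : star v * v = p) :
    v * p = v := by
  have : v - v * p = 0 := by
    apply aw_proper hAW
    rw [star_sub, star_mul, hp.1, sub_mul, mul_sub, mul_sub, ← mul_assoc, hv, hp.2,
      mul_assoc p, hv, hp.2, mul_assoc p, ← mul_assoc (star v), hv, hp.2, hp.2]
    simp
  exact (sub_eq_zero.1 this).symm

theorem star_zero_of {a b : R} (h : a * b = 0) : star b * star a = 0 := by
  rw [← star_mul, h, star_zero]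

theorem orth_symm {a b : R} (ha : star a = a) (hb : star b = b) (h : a * b = 0) : b * a = 0 := by
  have := star_zero_of h
  rwa [ha, hb] at this

theorem le_symm {a b : R} (ha : star a = a) (hb : star b = b) (h : a * b = a) : b * a = a := by
  have := congrArg star h
  rwa [star_mul, ha, hb] at this

theorem le_antisymm' {a b : R} (ha : star a = a) (hb : star b = b) (h : a * b = a)
    (h' : b * a = b) : a = b := by
  rw [← le_symm ha hb h, h']

theorem proj_sub {a b : R} (ha : IsProjection a) (hb : IsProjection b) (h : a * b = a) :
    IsProjection (b - a) := by
  refine ⟨by rw [star_sub, ha.1, hb.1], ?_⟩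
  rw [sub_mul, mul_sub, mul_sub, h, le_symm ha.1 hb.1 h, ha.2, hb.2]; simp

theorem proj_add {a b : R} (ha : IsProjection a) (hb : IsProjection b) (h : a * b = 0) :
    IsProjection (a + b) := by
  refine ⟨by rw [star_add, ha.1, hb.1], ?_⟩
  rw [add_mul, mul_add, mul_add, h, orth_symm ha.1 hb.1 h, ha.2, hb.2]; simp

theorem proj_mul {a b : R} (ha : IsProjection a) (hb : IsProjection b) (h : a * b = b * a) :
    IsProjection (a * b) := by
  refine ⟨by rw [star_mul, ha.1, hb.1, h], ?_⟩
  rw [mul_assoc, ← mul_assoc b, ← h, mul_assoc, hb.2, ← mul_assoc, ha.2]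

theorem proj_one_sub {a : R} (ha : IsProjection a) : IsProjection (1 - a) :=
  proj_sub ha ⟨star_one _, one_mul _⟩ (mul_one _)

section sup
variable {ι : Type*} {κ : Type*} {p : ι → R} {q : κ → R} {E F : R}

theorem IsS.le (h : IsS p E) (i : ι) : p i * E = p i := by
  have := (h.2 (1 - E)).2 (by rw [mul_sub, h.1.2, mul_one, sub_self]) i
  rw [mul_sub, mul_one] at this
  exact (sub_eq_zero.1 this).symm

theorem IsS.sup_le (h : IsS p E) {t : R} (ht : ∀ i, p i * t = p i) : E * t = E := by
  have := (h.2 (1 - t)).1 (fun i => by rw [mul_sub, ht i, mul_one, sub_self])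
  rw [mul_sub, mul_one] at this
  exact (sub_eq_zero.1 this).symm

theorem IsS.left (h : IsS p E) (hp : ∀ i, star (p i) = p i) {y : R} (hy : ∀ i, y * p i = 0) :
    y * E = 0 := by
  have := (h.2 (star y)).1 (fun i => by
    have := star_zero_of (hy i)
    rwa [hp] at this)
  have := star_zero_of this
  rwa [star_star, h.1.1] at this

theorem IsS.orth (h : IsS p E) (h' : IsS q F) (hq : ∀ i, star (q i) = q i)
    (hh : ∀ i k, p i * q k = 0) : E * F = 0 :=
  h'.left hq fun k => (h.2 _).1 fun i => hh i k

end sup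

theorem add_pi (hAW : IsAWStarRing R) (h2 : ∀ x : R, x + x = 0 → x = 0) {ι : Type*} {w : ι → R}
    {E F : R} (hw : ∀ i, w i * star (w i) * w i = w i)
    (ho : ∀ i j, i ≠ j → star (w i) * w j = 0) (ho' : ∀ i j, i ≠ j → w i * star (w j) = 0)
    (hE : IsS (fun i => star (w i) * w i) E) (hF : IsS (fun i => w i * star (w i)) F)
    (hEF : E * F = 0) : ProjEquiv E F := by
  have hFE : F * E = 0 := orth_symm hE.1.1 hF.1.1 hEF
  have hw' : ∀ i, star (w i) * w i * star (w i) = star (w i) := fun i => by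
    have := congrArg star (hw i)
    simpa [mul_assoc] using this
  have wE : ∀ i, w i * E = w i := fun i => by
    rw [← hw i, mul_assoc (w i), mul_assoc (w i), hE.le i]
  have wF : ∀ i, star (w i) * F = star (w i) := fun i => by
    rw [← hw' i, mul_assoc (star (w i)), mul_assoc (star (w i)), hF.le i]
  have Ew : ∀ i, E * star (w i) = star (w i) := fun i => by
    have := congrArg star (wE i); simpa [hE.1.1] using this
  have Fw : ∀ i, F * w i = w i := fun i => by
    have := congrArg star (wF i); simpa [hF.1.1] using this
  have ww : ∀ i j, w i * w j = 0 := fun i j => by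
    rw [← wE i, ← Fw j, mul_assoc, ← mul_assoc E, hEF, zero_mul, mul_zero]
  have sww : ∀ i j, star (w i) * star (w j) = 0 := fun i j => by
    rw [← star_mul, ww, star_zero]
  set P0 : ι → R := fun i => star (w i) * w i + w i * star (w i) + w i + star (w i) with hP0
  set Q0 : ι → R := fun i => star (w i) * w i + w i * star (w i) - w i - star (w i) with hQ0
  clear_value P0 Q0
  have sP : ∀ i, star (P0 i) = P0 i := fun i => by simp [hP0]; abel
  have sQ : ∀ i, star (Q0 i) = Q0 i := fun i => by simp [hQ0]; abel
  have pq : ∀ i j, P0 i * Q0 j = 0 := by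
    intro i j
    have l1 : ∀ y, w i * (w j * y) = 0 := fun y => by rw [← mul_assoc, ww, zero_mul]
    have l2 : ∀ y, star (w i) * (star (w j) * y) = 0 := fun y => by rw [← mul_assoc, sww, zero_mul]
    by_cases hij : i = j
    · subst hij
      have l3 := hw i
      have l4 := hw' i
      rw [mul_assoc] at l3 l4
      simp only [hP0, hQ0, mul_add, mul_sub, add_mul, mul_assoc, ww, sww, l1, l2, l3, l4, mul_zero]
      abel
    · have l3 : ∀ y, star (w i) * (w j * y) = 0 := fun y => by rw [← mul_assoc, ho i j hij, zero_mul]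
      have l4 : ∀ y, w i * (star (w j) * y) = 0 := fun y => by rw [← mul_assoc, ho' i j hij, zero_mul]
      simp only [hP0, hQ0, mul_add, mul_sub, add_mul, mul_assoc, ww, sww, l1, l2, l3, l4, mul_zero,
        ho i j hij, ho' i j hij]
      abel
  obtain ⟨P, hP⟩ := aw_set hAW P0
  obtain ⟨Q, hQ⟩ := aw_set hAW Q0
  have PQ : P * Q = 0 := hP.orth hQ sQ pq
  have QP : Q * P = 0 := orth_symm hP.1.1 hQ.1.1 PQ
  have Pp : ∀ i, P * P0 i = P0 i := fun i => le_symm (sP i) hP.1.1 (hP.le i)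
  have Qq : ∀ i, Q * Q0 i = Q0 i := fun i => le_symm (sQ i) hQ.1.1 (hQ.le i)
  have Pq : ∀ i, P * Q0 i = 0 := fun i => (hP.2 _).1 fun k => pq k i
  have Qp : ∀ i, Q * P0 i = 0 := fun i => (hQ.2 _).1 fun k => 
    orth_symm (sP i) (sQ k) (pq i k)
  have xx : (P - Q) * (P - Q) = P + Q := by
    rw [sub_mul, mul_sub, mul_sub, PQ, QP, hP.1.2, hQ.1.2]; abel
  have k1 : ∀ i, (P - Q) * (star (w i) * w i + w i * star (w i)) = w i + star (w i) := fun i => by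
    apply sub_eq_zero.1
    apply h2
    have : (P - Q) * (P0 i + Q0 i) = P0 i - Q0 i := by
      rw [sub_mul, mul_add, mul_add, Pp, Qq, Pq, Qp]; abel
    have e1 : P0 i + Q0 i = (star (w i) * w i + w i * star (w i)) +
      (star (w i) * w i + w i * star (w i)) := by simp only [hP0, hQ0]; abel
    have e2 : P0 i - Q0 i = (w i + star (w i)) + (w i + star (w i)) := by simp only [hP0, hQ0]; abel
    rw [e1, e2, mul_add] at this
    rw [sub_add_sub_comm, this, sub_self]
  have k2 : ∀ i, (P + Q) * (star (w i) * w i + w i * star (w i)) =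
      star (w i) * w i + w i * star (w i) := fun i => by
    apply sub_eq_zero.1
    apply h2
    have : (P + Q) * (P0 i + Q0 i) = P0 i + Q0 i := by
      rw [add_mul, mul_add, mul_add, Pp, Qq, Pq, Qp]; abel
    have e1 : P0 i + Q0 i = (star (w i) * w i + w i * star (w i)) +
      (star (w i) * w i + w i * star (w i)) := by simp only [hP0, hQ0]; abel
    rw [e1, mul_add] at this
    rw [sub_add_sub_comm, this, sub_self]
  have wF0 : ∀ i, w i * F = 0 := fun i => by rw [← wE i, mul_assoc, hEF, mul_zero]
  have wE0 : ∀ i, star (w i) * E = 0 := fun i => by rw [← wF i, mul_assoc, hFE, mul_zero]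
  have sE : ∀ i, star (star (w i) * w i) = star (w i) * w i := fun i => by simp
  have sF : ∀ i, star (w i * star (w i)) = w i * star (w i) := fun i => by simp
  have k1E : ∀ i, (P - Q) * (star (w i) * w i) = w i := fun i => by
    have := congrArg (· * E) (k1 i)
    simpa [mul_add, add_mul, mul_assoc, wE, wE0] using this
  have k1F : ∀ i, (P - Q) * (w i * star (w i)) = star (w i) := fun i => by
    have := congrArg (· * F) (k1 i)
    simpa [mul_add, add_mul, mul_assoc, wF, wF0] using this
  have k2E : ∀ i, (P + Q) * (star (w i) * w i) = star (w i) * w i := fun i => by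
    have := congrArg (· * E) (k2 i)
    simpa [mul_add, add_mul, mul_assoc, wE, wE0] using this
  have k2F : ∀ i, (P + Q) * (w i * star (w i)) = w i * star (w i) := fun i => by
    have := congrArg (· * F) (k2 i)
    simpa [mul_add, add_mul, mul_assoc, wF, wF0] using this
  set x := P - Q with hx
  have sx : star x = x := by rw [hx, star_sub, hP.1.1, hQ.1.1]
  have m1 : F * (x * E) = x * E := by
    have : ((1 - F) * x) * E = 0 := hE.left sE fun i => by
      rw [mul_assoc, k1E, sub_mul, Fw, one_mul, sub_self]
    rw [mul_assoc, sub_mul, one_mul] at this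
    exact (sub_eq_zero.1 this).symm
  have m2 : E * (x * F) = x * F := by
    have : ((1 - E) * x) * F = 0 := hF.left sF fun i => by
      rw [mul_assoc, k1F, sub_mul, Ew, one_mul, sub_self]
    rw [mul_assoc, sub_mul, one_mul] at this
    exact (sub_eq_zero.1 this).symm
  have m3 : x * (x * E) = E := by
    have : (x * x - 1) * E = 0 := hE.left sE fun i => by
      rw [xx, sub_mul, k2E, one_mul, sub_self]
    rw [sub_mul, one_mul, mul_assoc] at this
    exact sub_eq_zero.1 this
  have m4 : x * (x * F) = F := by
    have : (x * x - 1) * F = 0 := hF.left sF fun i => by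
      rw [xx, sub_mul, k2F, one_mul, sub_self]
    rw [sub_mul, one_mul, mul_assoc] at this
    exact sub_eq_zero.1 this
  have m5 : E * x = E * (x * F) := by
    have := congrArg star m1
    simp only [star_mul, sx, hE.1.1, hF.1.1, mul_assoc] at this
    exact this.symm
  refine ⟨x * E, ?_, ?_⟩
  · rw [star_mul, sx, hE.1.1, mul_assoc, m3, hE.1.2]
  · rw [star_mul, sx, hE.1.1, mul_assoc, ← mul_assoc E, hE.1.2, m5, m2, m4]

theorem add_equiv (hAW : IsAWStarRing R) (h2 : ∀ x : R, x + x = 0 → x = 0) {ι : Type*} {p q : ι → R}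
    {E F : R} (hp : ∀ i, IsProjection (p i)) (hq : ∀ i, IsProjection (q i))
    (ho : ∀ i j, i ≠ j → p i * p j = 0) (ho' : ∀ i j, i ≠ j → q i * q j = 0)
    (hpq : ∀ i, ProjEquiv (p i) (q i))
    (hE : IsS p E) (hF : IsS q F) (hEF : E * F = 0) : ProjEquiv E F := by
  choose w hw hw' using hpq
  have w1 : ∀ i, w i * p i = w i := fun i => aw_pi hAW (hp i) (hw i)
  have w2 : ∀ i, star (w i) * q i = star (w i) := fun i => aw_pi hAW (hq i) (by simpa using hw' i)
  have w1' : ∀ i, p i * star (w i) = star (w i) := fun i => by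
    have := congrArg star (w1 i); simpa [(hp i).1] using this
  have w2' : ∀ i, q i * w i = w i := fun i => by
    have := congrArg star (w2 i); simpa [(hq i).1] using this
  refine add_pi hAW h2 (w := w) (fun i => by rw [hw', w2']) (fun i j hij => ?_) (fun i j hij => ?_)
    (by simpa [hw] using hE) (by simpa [hw'] using hF) hEF
  · rw [← w2, ← w2' j, mul_assoc, ← mul_assoc (q i), ho' i j hij, zero_mul, mul_zero]
  · rw [← w1, ← w1' j, mul_assoc, ← mul_assoc (p i), ho i j hij, zero_mul, mul_zero]

def HasSign (R : Type*) [Ring R] [StarRing R] : Prop :=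
  ∀ b : R, star b = b → ∃ a d, star a = a ∧ star d = d ∧ a * d = 0 ∧ b = a - d ∧
    ∀ x, x * (b * b) = (b * b) * x → x * (a + d) = (a + d) * x

theorem sign_equiv (hAW : IsAWStarRing R) (hS : HasSign R) {e f b : R} (he : IsProjection e)
    (hf : IsProjection f) (hb : star b = b) (h : e * b = b * f) :
    ∃ r, IsProjection r ∧ r * e = e * r ∧ r * f = f * r ∧ (∀ y, b * y = 0 ↔ r * y = 0) ∧
      ∃ v, star v * v = f * r ∧ v * star v = e * r := by
  obtain ⟨a, d, ha, hd, had, hbad, hc⟩ := hS b hb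
  have h' : f * b = b * e := by
    have := congrArg star h
    simpa [he.1, hf.1, hb] using this.symm
  have ce : e * (a + d) = (a + d) * e := hc e (by rw [← mul_assoc, h, mul_assoc, h', mul_assoc])
  have cf : f * (a + d) = (a + d) * f := hc f (by rw [← mul_assoc, h', mul_assoc, h, mul_assoc])
  obtain ⟨p, hp, hpa⟩ := aw_one hAW a
  obtain ⟨q, hq, hqd⟩ := aw_one hAW d
  have pd : p * d = 0 := (hpa d).1 had
  have qa : q * a = 0 := (hqd a).1 (orth_symm ha hd had)
  have qp : q * p = 0 := (hqd p).1 (orth_symm hp.1 hd pd)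
  have pq : p * q = 0 := orth_symm hq.1 hp.1 qp
  have pa : p * a = a := by
    apply le_symm ha hp.1
    have := (hpa (1 - p)).2 (by rw [mul_sub, hp.2, mul_one, sub_self])
    rw [mul_sub, mul_one] at this; exact (sub_eq_zero.1 this).symm
  have qd : q * d = d := by
    apply le_symm hd hq.1
    have := (hqd (1 - q)).2 (by rw [mul_sub, hq.2, mul_one, sub_self])
    rw [mul_sub, mul_one] at this; exact (sub_eq_zero.1 this).symm
  have hr : IsProjection (p + q) := proj_add hp hq pq
  have hm : ∀ y, (a + d) * y = 0 ↔ (p + q) * y = 0 := fun y => by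
    constructor
    · intro hy
      have y1 : p * ((a + d) * y) = 0 := by rw [hy, mul_zero]
      have y2 : q * ((a + d) * y) = 0 := by rw [hy, mul_zero]
      rw [← mul_assoc, mul_add, pa, pd, add_zero] at y1
      rw [← mul_assoc, mul_add, qa, qd, zero_add] at y2
      rw [add_mul, (hpa y).1 y1, (hqd y).1 y2, add_zero]
    · intro hy
      have y1 : p * ((p + q) * y) = 0 := by rw [hy, mul_zero]
      have y2 : q * ((p + q) * y) = 0 := by rw [hy, mul_zero]
      rw [← mul_assoc, mul_add, hp.2, pq, add_zero] at y1
      rw [← mul_assoc, mul_add, qp, hq.2, zero_add] at y2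
      rw [add_mul, (hpa y).2 y1, (hqd y).2 y2, add_zero]
  have hbm : (p - q) * (a + d) = b := by
    rw [sub_mul, mul_add, mul_add, pa, pd, qa, qd, hbad]; abel
  have hmb : (p - q) * b = a + d := by
    rw [hbad, sub_mul, mul_sub, mul_sub, pa, pd, qa, qd]; abel
  have hb' : ∀ y, b * y = 0 ↔ (p + q) * y = 0 := fun y => by
    rw [← hm y]
    constructor
    · intro hy
      rw [← hmb, mul_assoc, hy, mul_zero]
    · intro hy
      rw [← hbm, mul_assoc, hy, mul_zero]
  have comm : ∀ g : R, star g = g → g * (a + d) = (a + d) * g → (p + q) * g = g * (p + q) := by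
    intro g hg hgm
    have h0 : (a + d) * (1 - (p + q)) = 0 :=
      (hm _).2 (by rw [mul_sub, hr.2, mul_one, sub_self])
    have h1 : (p + q) * (g * (1 - (p + q))) = 0 :=
      (hm _).1 (by rw [← mul_assoc, ← hgm, mul_assoc, h0, mul_zero])
    rw [mul_sub, mul_sub, mul_one] at h1
    have h3 := sub_eq_zero.1 h1
    have h4 := congrArg star h3
    rw [star_mul, star_mul, star_mul, hr.1, hg, mul_assoc, ← h3] at h4
    exact h4.symm
  have hss : (p - q) * (p - q) = p + q := by
    rw [sub_mul, mul_sub, mul_sub, pq, qp, hp.2, hq.2]; abel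
  have hsr : (p - q) * (p + q) = p - q := by
    rw [sub_mul, mul_add, mul_add, pq, qp, hp.2, hq.2]; abel
  have hs : star (p - q) = p - q := by rw [star_sub, hp.1, hq.1]
  have key : e * (p - q) = (p - q) * f := by
    have h1 : (e * (p - q) - (p - q) * f) * (a + d) = 0 := by
      rw [sub_mul, mul_assoc, hbm, mul_assoc, cf, ← mul_assoc, hbm, h, sub_self]
    have h2 := star_zero_of h1
    rw [star_add, ha, hd, hm] at h2
    have h3 := star_zero_of h2
    rw [star_star, hr.1, sub_mul, mul_assoc, hsr, mul_assoc, ← comm f hf.1 cf, ← mul_assoc, hsr] at h3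
    exact sub_eq_zero.1 h3
  refine ⟨p + q, hr, comm e he.1 ce, comm f hf.1 cf, hb', (p - q) * f, ?_, ?_⟩
  · rw [star_mul, hs, hf.1, mul_assoc, ← mul_assoc (p - q), hss, comm f hf.1 cf, ← mul_assoc, hf.2]
  · rw [star_mul, hs, hf.1, mul_assoc, ← mul_assoc f, hf.2, ← mul_assoc, ← key, mul_assoc, hss]

end Helpers

theorem hasSign_cstar {A : Type u} [CStarAlgebra A] : HasSign A := by
  intro b hb
  have hb' : IsSelfAdjoint b := hb
  refine ⟨cfc (fun x : ℝ => max x 0) b, cfc (fun x : ℝ => max (-x) 0) b, ?_, ?_, ?_, ?_, ?_⟩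
  · exact (cfc_predicate (R := ℝ) _ b : IsSelfAdjoint _)
  · exact (cfc_predicate (R := ℝ) _ b : IsSelfAdjoint _)
  · rw [← cfc_mul (R := ℝ) _ _ b]
    convert cfc_zero ℝ b using 2
    ext x
    rcases le_total x 0 with h | h <;> simp [h]
  · rw [← cfc_sub (R := ℝ) _ _ b]
    conv_lhs => rw [← cfc_id ℝ b]
    congr 1
    ext x
    rcases le_total x 0 with h | h <;> simp [h]
  · intro x hx
    have : cfc (fun x : ℝ => max x 0) b + cfc (fun x : ℝ => max (-x) 0) b = cfc Real.sqrt (b * b) := by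
      rw [← cfc_add (R := ℝ) b _ _, ← pow_two, ← cfc_comp_pow (R := ℝ) Real.sqrt 2 b]
      congr 1
      ext x
      rw [Real.sqrt_sq_eq_abs]
      rcases le_total x 0 with h | h <;> simp [h, abs_of_nonneg, abs_of_nonpos]
    rw [this]
    have hbb : IsSelfAdjoint (b * b) := by
      simp [IsSelfAdjoint, hb]
    have := hbb.commute_cfc (b := x) (show Commute (b * b) x from hx.symm) Real.sqrt
    exact this.symm

section Helpers2

variable {R : Type u} [Ring R] [StarRing R]

def SubE (p q : R) : Prop := ∃ v : R, star v * v = p ∧ q * v = v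

theorem SubE.trans {p q r : R} (h : SubE p q) (h' : SubE q r) : SubE p r := by
  obtain ⟨v, hv, hv'⟩ := h
  obtain ⟨w, hw, hw'⟩ := h'
  refine ⟨w * v, ?_, by rw [← mul_assoc, hw']⟩
  rw [star_mul, mul_assoc, ← mul_assoc (star w), hw, hv', hv]

theorem SubE.of_le {p q : R} (hp : IsProjection p) (hq : IsProjection q) (h : p * q = p) :
    SubE p q := ⟨p, by rw [hp.1, hp.2], le_symm hp.1 hq.1 h⟩

theorem SubE.mul_central {p q z : R} (hz : IsCentralProj z) (h : SubE p q) :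
    SubE (z * p) (z * q) := by
  obtain ⟨v, hv, hv'⟩ := h
  refine ⟨z * v, ?_, ?_⟩
  · rw [star_mul, hz.1.1, mul_assoc, ← mul_assoc z, hz.1.2, hz.2 v, ← mul_assoc, hv, hz.2]
  · rw [mul_assoc, ← mul_assoc q, ← hz.2 q, mul_assoc, hv', ← mul_assoc, hz.1.2]

theorem SubE.add {p q p' q' : R} (hq : IsProjection q) (hq' : IsProjection q')
    (h : SubE p q) (h' : SubE p' q') (hqq : q * q' = 0) : SubE (p + p') (q + q') := by
  obtain ⟨v, hv, hv1⟩ := h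
  obtain ⟨w, hw, hw1⟩ := h'
  have hqq' : q' * q = 0 := orth_symm hq.1 hq'.1 hqq
  have a1 : q * w = 0 := by rw [← hw1, ← mul_assoc, hqq, zero_mul]
  have a2 : q' * v = 0 := by rw [← hv1, ← mul_assoc, hqq', zero_mul]
  have a3 : star v * w = 0 := by
    have : star v * q = star v := by
      have := congrArg star hv1; rwa [star_mul, hq.1] at this
    rw [← this, mul_assoc, a1, mul_zero]
  have a4 : star w * v = 0 := by
    have := star_zero_of a3; rwa [star_star] at this
  refine ⟨v + w, ?_, ?_⟩
  · rw [star_add, add_mul, mul_add, mul_add, a3, a4, hv, hw]; abel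
  · rw [add_mul, mul_add, mul_add, a1, a2, hv1, hw1]; abel

theorem ProjEquiv.symm' {p q : R} (h : ProjEquiv p q) : ProjEquiv q p := by
  obtain ⟨v, h1, h2⟩ := h
  exact ⟨star v, by rwa [star_star], by rwa [star_star]⟩

theorem aw_pi' (hAW : IsAWStarRing R) {v p : R} (hp : IsProjection p) (hv : v * star v = p) :
    p * v = v := by
  have := aw_pi hAW (v := star v) hp (by rwa [star_star])
  have := congrArg star this
  rwa [star_mul, star_star, hp.1] at this

theorem ProjEquiv.subE (hAW : IsAWStarRing R) {p q : R} (hq : IsProjection q)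
    (h : ProjEquiv p q) : SubE p q := by
  obtain ⟨v, h1, h2⟩ := h
  exact ⟨v, h1, aw_pi' hAW hq h2⟩

theorem ProjSubEquiv.subE (hAW : IsAWStarRing R) {p q : R} (hq : IsProjection q)
    (h : ProjSubEquiv p q) : SubE p q := by
  obtain ⟨p', hp', hle, he⟩ := h
  exact (he.subE hAW hp').trans (SubE.of_le hp' hq hle)

theorem proj_final (hAW : IsAWStarRing R) {p v : R} (hp : IsProjection p) (hv : star v * v = p) :
    IsProjection (v * star v) := by
  refine ⟨by simp, ?_⟩
  rw [mul_assoc, ← mul_assoc (star v), hv, ← mul_assoc, aw_pi hAW hp hv]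

theorem central_proj_mul {z p : R} (hz : IsCentralProj z) (hp : IsProjection p) :
    IsProjection (z * p) := proj_mul hz.1 hp (hz.2 p)

theorem central_one_sub {z : R} (hz : IsCentralProj z) : IsCentralProj (1 - z) :=
  ⟨proj_one_sub hz.1, fun a => by rw [sub_mul, mul_sub, hz.2, one_mul, mul_one]⟩

theorem zorn_orth {α : Type*} (Q : α → Prop) (O : α → α → Prop) :
    ∃ F : Set α, (∀ x ∈ F, Q x) ∧ (∀ x ∈ F, ∀ y ∈ F, x ≠ y → O x y) ∧
      ∀ y, Q y → (∀ x ∈ F, O x y ∧ O y x) → y ∈ F := by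
  obtain ⟨F, hF⟩ := zorn_subset
    {F : Set α | (∀ x ∈ F, Q x) ∧ (∀ x ∈ F, ∀ y ∈ F, x ≠ y → O x y)} (by
      intro c hc hch
      refine ⟨⋃₀ c, ⟨?_, ?_⟩, fun s hs => Set.subset_sUnion_of_mem hs⟩
      · rintro x ⟨s, hs, hx⟩
        exact (hc hs).1 x hx
      · rintro x ⟨s, hs, hx⟩ y ⟨s', hs', hy⟩ hxy
        rcases hch.total hs hs' with h | h
        · exact (hc hs').2 x (h hx) y hy hxy
        · exact (hc hs).2 x hx y (h hy) hxy)
  refine ⟨F, hF.prop.1, hF.prop.2, fun y hy ho => ?_⟩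
  have : insert y F ⊆ F := hF.le_of_ge (y := insert y F) (by
    refine ⟨?_, ?_⟩
    · rintro x (rfl | hx)
      · exact hy
      · exact hF.prop.1 x hx
    · rintro x (rfl | hx) z (rfl | hz) hxz
      · exact absurd rfl hxz
      · exact (ho z hz).2
      · exact (ho x hx).1
      · exact hF.prop.2 x hx z hz hxz) (Set.subset_insert y F)
  exact this (Set.mem_insert y F)

theorem schroeder (hAW : IsAWStarRing R) {e j : R} (he : IsProjection e) (hj : IsProjection j)
    (hej : e * j = e) (h : SubE j e) : ProjEquiv j e := by
  obtain ⟨v, hv, hev⟩ := h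
  have hje : j * e = e := le_symm he.1 hj.1 hej
  have vj : v * j = v := aw_pi hAW hj hv
  have jv : j * v = v := by rw [← hev, ← mul_assoc, hje]
  have jsv : j * star v = star v := by have := congrArg star vj; rwa [star_mul, hj.1] at this
  have svj : star v * j = star v := by have := congrArg star jv; rwa [star_mul, hj.1] at this
  have sve : star v * e = star v := by have := congrArg star hev; rwa [star_mul, he.1] at this
  have hd : IsProjection (j - e) := proj_sub he hj hej
  have dv : (j - e) * v = 0 := by rw [sub_mul, jv, hev, sub_self]
  have svd : star v * (j - e) = 0 := by rw [mul_sub, svj, sve, sub_self]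
  let φ : R → R := fun g => (j - e) + v * g * star v
  have hφ : ∀ g, φ g = (j - e) + v * g * star v := fun g => rfl
  have mono : ∀ g g', g * j = g → g * g' = g → φ g * φ g' = φ g := by
    intro g g' hg hgg
    have a1 : (j - e) * (v * g' * star v) = 0 := by
      rw [mul_assoc, ← mul_assoc, dv, zero_mul]
    have a2 : v * g * star v * (j - e) = 0 := by rw [mul_assoc, svd, mul_zero]
    have a3 : v * g * star v * (v * g' * star v) = v * g * star v := by
      calc v * g * star v * (v * g' * star v) = v * (g * (star v * v) * g') * star v := by noncomm_ring
        _ = _ := by rw [hv, hg, hgg]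
    rw [hφ, hφ, add_mul, mul_add, mul_add, a1, a2, a3, hd.2]; abel
  have φs : ∀ g, star g = g → star (φ g) = φ g := by
    intro g hg
    rw [hφ, star_add, hd.1, star_mul, star_mul, star_star, hg, mul_assoc]
  have φj : ∀ g, φ g * j = φ g := fun g => by
    rw [hφ, add_mul, mul_assoc _ (star v), svj, sub_mul, hj.2, hej]
  obtain ⟨g, hg⟩ := aw_set hAW
    (fun g : {g : R // IsProjection g ∧ g * j = g ∧ g * φ g = g} => g.1)
  have gj : g * j = g := hg.sup_le fun i => i.2.2.1
  have g1 : g * φ g = g := hg.sup_le fun i => by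
    have h1 : φ i.1 * φ g = φ i.1 := mono _ _ i.2.2.1 (hg.le i)
    rw [← i.2.2.2, mul_assoc, h1]
  have g2 : φ g * g = φ g := by
    have hP : IsProjection (φ g) := ⟨φs g hg.1.1, mono _ _ gj hg.1.2⟩
    exact hg.le ⟨φ g, hP, φj g, mono _ _ gj g1⟩
  have g3 : g = φ g := le_antisymm' hg.1.1 (φs g hg.1.1) g1 g2
  have jg : j * g = g := le_symm hg.1.1 hj.1 gj
  have vgv : v * g * star v = g - (j - e) := by
    rw [hφ] at g3
    exact (sub_eq_of_eq_add' g3).symm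
  have dg : (j - e) * g = j - e := by
    rw [g3, hφ, mul_add, hd.2, mul_assoc, ← mul_assoc, dv, zero_mul, add_zero]
  have gd : g * (j - e) = j - e := le_symm hd.1 hg.1.1 dg
  have c1 : (j - g) * (v * g) = 0 := by
    have : v * g = (v * g * star v) * v := by rw [mul_assoc _ (star v), hv, mul_assoc, gj]
    rw [this, vgv, ← mul_assoc]
    have : (j - g) * (g - (j - e)) = 0 := by
      rw [sub_mul, mul_sub, mul_sub j j, mul_sub g g, jg, hg.1.2, gd, hj.2, hje, sub_self]
    rw [this, zero_mul]
  have hjg : IsProjection (j - g) := proj_sub hg.1 hj gj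
  have c2 : (g * star v) * (j - g) = 0 := by
    have := star_zero_of c1
    rwa [star_mul, hg.1.1, hjg.1] at this
  have c3 : g * (j - g) = 0 := by rw [mul_sub, gj, hg.1.2, sub_self]
  have c4 : (j - g) * g = 0 := orth_symm hg.1.1 hjg.1 c3
  refine ⟨v * g + (j - g), ?_, ?_⟩
  · rw [star_add, star_mul, hg.1.1, hjg.1, add_mul, mul_add, mul_add, c1, c2, hjg.2,
      mul_assoc, ← mul_assoc (star v), hv, jg, hg.1.2]
    abel
  · rw [star_add, star_mul, hg.1.1, hjg.1, add_mul, mul_add, mul_add, hjg.2, mul_assoc v g, mul_assoc v g, c3,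
      ← mul_assoc (j - g), c4, ← mul_assoc g, hg.1.2, ← mul_assoc v, vgv]
    simp

theorem finite_sub (hAW : IsAWStarRing R) {p q : R} (hp : IsProjection p) (hq : IsProjection q)
    (hfin : ProjFinite q) (h : SubE p q) : ProjFinite p := by
  intro p' hp' ⟨x, hx, hx'⟩ hle
  change p' * p = p' at hle
  obtain ⟨v, hv, hqv⟩ := h
  have vp : v * p = v := aw_pi hAW hp hv
  have xp : x * p = x := aw_pi hAW hp hx
  have p'x : p' * x = x := aw_pi' hAW hp' hx'
  have px : p * x = x := by rw [← p'x, ← mul_assoc, le_symm hp'.1 hp.1 hle]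
  have pv : p * star v = star v := by have := congrArg star vp; rwa [star_mul, hp.1] at this
  have svq : star v * q = star v := by have := congrArg star hqv; rwa [star_mul, hq.1] at this
  have pxs : p * star x = star x := by have := congrArg star xp; rwa [star_mul, hp.1] at this
  have hP1 : IsProjection (v * star v) := proj_final hAW hp hv
  have hle1 : v * star v * q = v * star v := by rw [mul_assoc, svq]
  have hk : IsProjection (q - v * star v) := proj_sub hP1 hq hle1
  have kv : (q - v * star v) * v = 0 := by rw [sub_mul, hqv, mul_assoc, hv, vp, sub_self]
  have vk : star v * (q - v * star v) = 0 := by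
    have := star_zero_of kv; rwa [hk.1] at this
  set k := q - v * star v with hkdef
  have y1 : star (v * x * star v + k) * (v * x * star v + k) = q := by
    have a1 : star (v * x * star v) * (v * x * star v) = v * star v := by
      calc star (v * x * star v) * (v * x * star v) = v * (star x * ((star v * v) * x)) * star v := by
            simp only [star_mul, star_star]; noncomm_ring
        _ = _ := by rw [hv, px, hx, vp]
    have a2 : star (v * x * star v) * k = 0 := by
      simp only [star_mul, star_star, mul_assoc, vk, mul_zero]
    have a3 : k * (v * x * star v) = 0 := by
      rw [mul_assoc, ← mul_assoc, kv, zero_mul]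
    rw [star_add, add_mul, mul_add, mul_add, a1, a2, hk.1, a3, hk.2, hkdef]; abel
  have y2 : (v * x * star v + k) * star (v * x * star v + k) = v * p' * star v + k := by
    have a1 : (v * x * star v) * star (v * x * star v) = v * p' * star v := by
      calc (v * x * star v) * star (v * x * star v) = v * (x * (star v * v) * star x) * star v := by
            simp only [star_mul, star_star]; noncomm_ring
        _ = _ := by rw [hv, xp, hx']
    have a2 : (v * x * star v) * k = 0 := by
      simp only [mul_assoc, vk, mul_zero]
    have a3 : k * star (v * x * star v) = 0 := by
      have := star_zero_of a2; rwa [hk.1] at this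
    rw [star_add, add_mul, mul_add, mul_add, a1, hk.1, a2, a3, hk.2]; abel
  have hq' : IsProjection (v * p' * star v + k) := by
    rw [← y2]; exact proj_final hAW hq y1
  have := hfin _ hq' ⟨_, y1, y2⟩ (by
    change _ * q = _
    rw [add_mul, mul_assoc, svq, hkdef, sub_mul, hq.2, hle1])
  have e1 : v * p' * star v = v * star v := by
    rw [hkdef] at this
    have := eq_sub_of_add_eq this
    rw [this]; abel
  have e2 : star v * (v * p' * star v) * v = star v * (v * star v) * v := by rw [e1]
  have l : star v * (v * p' * star v) * v = p * p' * p := by rw [← hv]; noncomm_ring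
  have r : star v * (v * star v) * v = p * p := by rw [← hv]; noncomm_ring
  rw [l, r, le_symm hp'.1 hp.1 hle, hle, hp.2] at e2
  exact e2

theorem parallelogram (hAW : IsAWStarRing R) (hS : HasSign R) {e f j : R} (he : IsProjection e)
    (hf : IsProjection f) (hj : IsJoinProj e f j) : SubE (j - e) f := by
  obtain ⟨hjP, hej, hfj, hmin⟩ := hj
  change e * j = e at hej
  obtain ⟨r, hr, hre, hrf, hb, v, hv, hv'⟩ := sign_equiv hAW hS (e := 1 - e) (f := f) (b := f - e)
    (proj_one_sub he) hf (by rw [star_sub, he.1, hf.1])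
    (by simp only [sub_mul, mul_sub, he.2, hf.2, one_mul]; abel)
  have hgP : IsProjection ((1 - e) * r) := proj_mul (proj_one_sub he) hr hre.symm
  have hfr : IsProjection (f * r) := proj_mul hf hr hrf.symm
  have e0 : e * ((1 - e) * r) = 0 := by rw [← mul_assoc, mul_sub, he.2, mul_one, sub_self, zero_mul]
  have hre' : r * e = e * r := by
    rw [mul_sub, sub_mul, mul_one, one_mul] at hre
    exact sub_right_injective hre
  have ht : IsProjection (e + (1 - e) * r) := proj_add he hgP e0
  have h1 : (f - e) * (1 - r) = 0 := (hb _).2 (by rw [mul_sub, hr.2, mul_one, sub_self])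
  have h2 : f * (1 - r) = e * (1 - r) := by
    rw [sub_mul] at h1; exact sub_eq_zero.1 h1
  have hft : f * (e + (1 - e) * r) = f := by
    have : f - f * (e + (1 - e) * r) = f * (1 - r) * (1 - e) := by
      simp only [mul_add, mul_sub, sub_mul, mul_one, one_mul, mul_assoc, hre']; abel
    rw [h2] at this
    have h3 : e * (1 - r) * (1 - e) = 0 := by
      simp only [mul_sub, sub_mul, mul_one, mul_assoc, hre', he.2]
      rw [← mul_assoc e e, he.2]; abel
    rw [h3] at this
    exact (sub_eq_zero.1 this).symm
  have hjt := hmin _ ht (by change e * _ = e; rw [mul_add, e0, he.2, add_zero]) hft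
  change j * _ = j at hjt
  have hle : (j - e) * ((1 - e) * r) = j - e := by
    rw [sub_mul, e0, sub_zero]
    rw [mul_add, le_symm he.1 hjP.1 hej] at hjt
    exact eq_sub_of_add_eq' hjt
  refine (SubE.of_le (proj_sub he hjP hej) hgP hle).trans ⟨star v, by rwa [star_star], ?_⟩
  have := aw_pi hAW hfr hv
  have := congrArg star this
  rw [star_mul, hfr.1] at this
  rw [← this, ← mul_assoc, ← mul_assoc, hf.2]

end Helpers2

section Helpers3

variable {R : Type u} [Ring R] [StarRing R]

theorem gc_orth (hAW : IsAWStarRing R) (h2 : ∀ x : R, x + x = 0 → x = 0) (hS : HasSign R)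
    {e f : R} (he : IsProjection e) (hf : IsProjection f) (hef : e * f = 0) :
    ∃ h, IsCentralProj h ∧ SubE (h * e) (h * f) ∧ SubE ((1 - h) * f) ((1 - h) * e) := by
  obtain ⟨S, hS1, hS2, hS3⟩ := zorn_orth
    (fun w : R => w * star w * w = w ∧ w * e = w ∧ f * w = w)
    (fun w w' => star w * w' = 0 ∧ w * star w' = 0)
  obtain ⟨E, hE⟩ := aw_set hAW (fun w : S => star w.1 * w.1)
  obtain ⟨F, hF⟩ := aw_set hAW (fun w : S => w.1 * star w.1)
  have hEe : E * e = E := hE.sup_le fun w => by rw [mul_assoc, (hS1 _ w.2).2.1]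
  have hFf : F * f = F := hF.sup_le fun w => by
    have := congrArg star (hS1 _ w.2).2.2
    rw [star_mul, hf.1] at this
    rw [mul_assoc, this]
  have hEF : E * F = 0 := by
    rw [← hEe, ← le_symm hF.1.1 hf.1 hFf, mul_assoc, ← mul_assoc e, hef, zero_mul, mul_zero]
  have hEq : ProjEquiv E F := add_pi hAW h2 (w := fun w : S => w.1) (fun w => (hS1 _ w.2).1)
    (fun i j hij => (hS2 _ i.2 _ j.2 (fun h => hij (Subtype.ext h))).1)
    (fun i j hij => (hS2 _ i.2 _ j.2 (fun h => hij (Subtype.ext h))).2) hE hF hEF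
  have he0 : IsProjection (e - E) := proj_sub hE.1 he hEe
  have hf0 : IsProjection (f - F) := proj_sub hF.1 hf hFf
  have hfe : f * e = 0 := orth_symm he.1 hf.1 hef
  have eE : e * E = E := le_symm hE.1.1 he.1 hEe
  have fF : f * F = F := le_symm hF.1.1 hf.1 hFf
  have Ee0 : E * (e - E) = 0 := by rw [mul_sub, hEe, hE.1.2, sub_self]
  have e0E : (e - E) * E = 0 := by rw [sub_mul, eE, hE.1.2, sub_self]
  have Ff0 : F * (f - F) = 0 := by rw [mul_sub, hFf, hF.1.2, sub_self]
  have e0e : (e - E) * e = e - E := by rw [sub_mul, he.2, hEe]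
  have ff0 : f * (f - F) = f - F := by rw [mul_sub, hf.2, fF]
  have f0e0 : (f - F) * (e - E) = 0 := by
    have h1 : f * (e - E) = 0 := by rw [mul_sub, hfe, ← eE, ← mul_assoc, hfe]; simp
    have h3 : F * (e - E) = 0 := by rw [← hFf, mul_assoc, h1, mul_zero]
    rw [sub_mul, h1, h3, sub_self]
  set e0 := e - E with he0d
  set f0 := f - F with hf0d
  clear_value e0 f0
  have e0f0 : e0 * f0 = 0 := orth_symm hf0.1 he0.1 f0e0
  have key : ∀ a, f0 * (a * e0) = 0 := by
    intro a
    set x := f0 * (a * e0) with hx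
    have xf : f0 * x = x := by rw [hx, ← mul_assoc, hf0.2]
    have xe : x * e0 = x := by rw [hx, mul_assoc, mul_assoc, he0.2]
    have sxf : star x * f0 = star x := by have := congrArg star xf; rwa [star_mul, hf0.1] at this
    have sxe : e0 * star x = star x := by have := congrArg star xe; rwa [star_mul, he0.1] at this
    have z1 : f0 * star x = 0 := by rw [← sxe, ← mul_assoc, f0e0, zero_mul]
    have z2 : star x * e0 = 0 := by rw [← sxf, mul_assoc, f0e0, mul_zero]
    have b1 : (x + star x) * e0 = x := by rw [add_mul, xe, z2, add_zero]
    obtain ⟨r, hr, hrf, hre, hb, v, hv, hv'⟩ := sign_equiv hAW hS (e := f0) (f := e0)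
      (b := x + star x) hf0 he0 (by rw [star_add, star_star, add_comm])
      (by rw [b1, mul_add, xf, z1, add_zero])
    have p1 : IsProjection (e0 * r) := proj_mul he0 hr hre.symm
    have p2 : IsProjection (f0 * r) := proj_mul hf0 hr hrf.symm
    have v1 : v * (e0 * r) = v := aw_pi hAW p1 hv
    have v2 : f0 * r * v = v := aw_pi' hAW p2 hv'
    have ve0 : v * e0 = v := by
      rw [← v1, ← hre, mul_assoc, mul_assoc, he0.2]
    have f0v : f0 * v = v := by
      rw [← v2, ← mul_assoc, ← mul_assoc, hf0.2]
    have hmem : v ∈ S := hS3 v ⟨by rw [hv', v2], by rw [← ve0, mul_assoc, e0e],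
      by rw [← f0v, ← mul_assoc, ff0]⟩ (by
        intro w hw
        have w1 : w * E = w := by
          have := hE.le ⟨w, hw⟩
          rw [← (hS1 w hw).1, mul_assoc w, mul_assoc w, this]
        have w2 : F * w = w := by
          have := le_symm (by simp) hF.1.1 (hF.le ⟨w, hw⟩)
          rw [← (hS1 w hw).1, ← mul_assoc, this]
        have w3 : star w * F = star w := by have := congrArg star w2; rwa [star_mul, hF.1.1] at this
        have q1 : star w * v = 0 := by
          rw [← w3, ← f0v, mul_assoc, ← mul_assoc F, Ff0, zero_mul, mul_zero]
        have q2 : v * star w = 0 := by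
          have : E * star w = star w := by
            have := congrArg star w1; rwa [star_mul, hE.1.1] at this
          rw [← this, ← ve0, mul_assoc, ← mul_assoc e0, e0E, zero_mul, mul_zero]
        have q3 := star_zero_of q1
        have q4 := star_zero_of q2
        rw [star_star] at q3 q4
        exact ⟨⟨q1, q4⟩, ⟨q3, q2⟩⟩)
    have hz : star v * v = 0 := by
      have := hE.le ⟨v, hmem⟩
      rw [← this, mul_assoc]
      have : v * E = 0 := by rw [← ve0, mul_assoc, e0E, mul_zero]
      rw [this, mul_zero]
    rw [hv, ← hre] at hz
    rw [← b1]
    exact (hb _).2 hz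
  obtain ⟨r, hr⟩ := aw_set hAW (fun a : R => f0 * a)
  have rc : ∀ b, r * (b * (1 - r)) = 0 := fun b => (hr.2 _).1 fun a => by
    have := (hr.2 (1 - r)).2 (by rw [mul_sub, hr.1.2, mul_one, sub_self]) (a * b)
    simp only [mul_assoc] at this ⊢
    exact this
  have rc' : ∀ b, r * b = r * (b * r) := fun b => by
    have := rc b
    rw [mul_sub, mul_sub, mul_one] at this
    exact sub_eq_zero.1 this
  have hrz : IsCentralProj r := by
    refine ⟨hr.1, fun b => ?_⟩
    have h3 := congrArg star (rc' (star b))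
    simp only [star_mul, star_star, hr.1.1, mul_assoc] at h3
    rw [h3, rc']
  have re0 : r * e0 = 0 := (hr.2 _).1 fun a => by rw [mul_assoc]; exact key a
  have rf0 : (1 - r) * f0 = 0 := by
    have := (hr.2 (1 - r)).2 (by rw [mul_sub, hr.1.2, mul_one, sub_self]) 1
    simp only [mul_one] at this
    exact orth_symm hf0.1 (proj_one_sub hr.1).1 this
  have re : r * e = r * E := by
    rw [he0d, mul_sub] at re0; exact sub_eq_zero.1 re0
  have rf : (1 - r) * f = (1 - r) * F := by
    rw [hf0d, mul_sub (1 - r)] at rf0; exact sub_eq_zero.1 rf0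
  refine ⟨r, hrz, ?_, ?_⟩
  · rw [re]
    exact ((hEq.subE hAW hF.1).trans (SubE.of_le hF.1 hf hFf)).mul_central hrz
  · rw [rf]
    exact ((hEq.symm'.subE hAW hE.1).trans (SubE.of_le hE.1 he hEe)).mul_central
      (central_one_sub hrz)

theorem gc (hAW : IsAWStarRing R) (h2 : ∀ x : R, x + x = 0 → x = 0) (hS : HasSign R)
    {e f : R} (he : IsProjection e) (hf : IsProjection f) :
    ∃ h, IsCentralProj h ∧ SubE (h * e) (h * f) ∧ SubE ((1 - h) * f) ((1 - h) * e) := by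
  obtain ⟨r, hr, hre, hrf, hb, hv⟩ := sign_equiv hAW hS (e := e) (f := f) (b := e + f - 1)
    he hf (by rw [star_sub, star_add, he.1, hf.1, star_one])
    (by simp only [mul_sub, mul_add, sub_mul, add_mul, he.2, hf.2, one_mul, mul_one]; abel)
  have h1 : (e + f - 1) * (1 - r) = 0 := (hb _).2 (by rw [mul_sub, hr.2, mul_one, sub_self])
  have hr' := proj_one_sub hr
  have cre : (1 - r) * e = e * (1 - r) := by rw [sub_mul, mul_sub, hre, one_mul, mul_one]
  have crf : (1 - r) * f = f * (1 - r) := by rw [sub_mul, mul_sub, hrf, one_mul, mul_one]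
  have pe := proj_mul he hr hre.symm
  have pf := proj_mul hf hr hrf.symm
  have pe' := proj_mul he hr' cre.symm
  have pf' := proj_mul hf hr' crf.symm
  have h3 : e * f * (1 - r) = 0 := by
    have : e * ((e + f - 1) * (1 - r)) = e * f * (1 - r) := by
      rw [← mul_assoc, mul_sub e, mul_add, he.2, mul_one]; congr 1; abel
    rw [← this, h1, mul_zero]
  have ho : e * (1 - r) * (f * (1 - r)) = 0 := by
    rw [mul_assoc, ← mul_assoc (1 - r), crf, mul_assoc, hr'.2, ← mul_assoc, h3]
  have rr : r * (1 - r) = 0 := by rw [mul_sub, hr.2, mul_one, sub_self]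
  have o1 : ∀ g : R, r * g = g * r → g * r * (g * (1 - r)) = 0 := fun g hg => by
    have hg' : (1 - r) * g = g * (1 - r) := by rw [sub_mul, mul_sub, hg, one_mul, mul_one]
    rw [← hg', mul_assoc, ← mul_assoc r, rr, zero_mul, mul_zero]
  have s1 : ∀ g : R, g = g * r + g * (1 - r) := fun g => by rw [mul_sub, mul_one]; abel
  obtain ⟨v, hv1, hv2⟩ := hv
  have efr : ProjEquiv (f * r) (e * r) := ⟨v, hv1, hv2⟩
  have c1 : SubE (e * r) (f * r) := efr.symm'.subE hAW pf
  have c2 : SubE (f * r) (e * r) := efr.subE hAW pe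
  obtain ⟨h, hh, a1, a2⟩ := gc_orth hAW h2 hS pe' pf' ho
  have hh' := central_one_sub hh
  have ortho : ∀ z g : R, IsCentralProj z → r * g = g * r →
      z * (g * r) * (z * (g * (1 - r))) = 0 := fun z g hz hg => by
    rw [mul_assoc, ← mul_assoc _ z, ← hz.2, mul_assoc, o1 g hg, mul_zero, mul_zero]
  refine ⟨h, hh, ?_, ?_⟩
  · rw [s1 e, s1 f, mul_add, mul_add]
    exact SubE.add (central_proj_mul hh pf) (central_proj_mul hh pf') (c1.mul_central hh) a1
      (ortho h f hh hrf)
  · rw [s1 e, s1 f, mul_add, mul_add]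
    exact SubE.add (central_proj_mul hh' pe) (central_proj_mul hh' pe') (c2.mul_central hh') a2
      (ortho _ e hh' hre)

/-- doubling data -/
structure Dbl (t u u1 u2 : R) : Prop where
  pt : IsProjection t
  pu : IsProjection u
  p1 : IsProjection u1
  p2 : IsProjection u2
  tu : t * u = 0
  l1 : u1 * u = u1
  l2 : u2 * u = u2
  o : u1 * u2 = 0
  e0 : ProjEquiv t u
  e1 : ProjEquiv t u1
  e2 : ProjEquiv t u2

theorem Dbl.sub (hAW : IsAWStarRing R) {t u u1 u2 : R} (h : Dbl t u u1 u2) :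
    SubE (t + u) u ∧ SubE (t + u) t := by
  have h1 : SubE (t + u) (u1 + u2) := SubE.add h.p1 h.p2 (h.e1.subE hAW h.p1)
    ((h.e0.symm'.subE hAW h.pt).trans (h.e2.subE hAW h.p2)) h.o
  have h2 : SubE (t + u) u := h1.trans (SubE.of_le (proj_add h.p1 h.p2 h.o) h.pu
    (by rw [add_mul, h.l1, h.l2]))
  exact ⟨h2, h2.trans (h.e0.symm'.subE hAW h.pt)⟩

theorem infinite_dbl (hAW : IsAWStarRing R) (h2 : ∀ x : R, x + x = 0 → x = 0)
    {e : R} (he : IsProjection e) (hinf : ¬ ProjFinite e) :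
    ∃ t u u1 u2, Dbl t u u1 u2 ∧ t * e = t ∧ u * e = u ∧ t ≠ 0 := by
  unfold ProjFinite at hinf
  push Not at hinf
  obtain ⟨e', he', ⟨v, hv, hv'⟩, hle, hne⟩ := hinf
  change e' * e = e' at hle
  have ve : v * e = v := aw_pi hAW he hv
  have e'v : e' * v = v := aw_pi' hAW he' hv'
  have ev : e * v = v := by rw [← e'v, ← mul_assoc, le_symm he'.1 he.1 hle]
  have hd : IsProjection (e - e') := proj_sub he' he hle
  have dv : (e - e') * v = 0 := by rw [sub_mul, ev, e'v, sub_self]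
  have ed : e * (e - e') = e - e' := by rw [mul_sub, he.2, le_symm he'.1 he.1 hle]
  have hd0 : e - e' ≠ 0 := fun h => hne (sub_eq_zero.1 h).symm
  set d := e - e' with hdd
  clear_value d
  let a : ℕ → R := fun n => Nat.rec d (fun _ x => v * x) n
  have a0 : a 0 = d := rfl
  have as : ∀ n, a (n + 1) = v * a n := fun n => rfl
  clear_value a
  have ea : ∀ n, e * a n = a n := fun n => by
    cases n with
    | zero => rw [a0, ed]
    | succ n => rw [as, ← mul_assoc, ev]
  have ad : ∀ n, a n * d = a n := fun n => by
    induction n with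
    | zero => rw [a0, hd.2]
    | succ n ih => rw [as, mul_assoc, ih]
  have aa : ∀ n, star (a n) * a n = d := fun n => by
    induction n with
    | zero => rw [a0, hd.1, hd.2]
    | succ n ih => rw [as, star_mul, mul_assoc, ← mul_assoc (star v), hv, ea, ih]
  have ao : ∀ n m, n ≠ m → star (a n) * a m = 0 := fun n => by
    induction n with
    | zero =>
      intro m hm
      cases m with
      | zero => exact absurd rfl hm
      | succ m => rw [a0, as, hd.1, ← mul_assoc, dv, zero_mul]
    | succ n ih =>
      intro m hm
      cases m with
      | zero =>
        have : star v * d = 0 := by have := star_zero_of dv; rwa [hd.1] at this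
        rw [a0, as, star_mul, mul_assoc, this, mul_zero]
      | succ m =>
        rw [as, as, star_mul, mul_assoc, ← mul_assoc (star v), hv, ea, ih m (by omega)]
  let E : ℕ → R := fun n => a n * star (a n)
  have hE : ∀ n, E n = a n * star (a n) := fun n => rfl
  clear_value E
  have EP : ∀ n, IsProjection (E n) := fun n => by rw [hE]; exact proj_final hAW hd (aa n)
  have Eo : ∀ n m, n ≠ m → E n * E m = 0 := fun n m h => by
    rw [hE, hE, mul_assoc, ← mul_assoc (star (a n)), ao n m h, zero_mul, mul_zero]
  have Ee : ∀ n, E n * e = E n := fun n => by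
    have := congrArg star (ea n)
    rw [star_mul, he.1] at this
    rw [hE, mul_assoc, this]
  have Eq : ∀ n m, ProjEquiv (E n) (E m) := fun n m => by
    have h1 : ProjEquiv (E n) d := ⟨star (a n), by rw [star_star, hE], by rw [star_star, aa]⟩
    refine ⟨a m * star (a n), ?_, ?_⟩
    · rw [star_mul, star_star, mul_assoc, ← mul_assoc (star (a m)), aa, ← mul_assoc, ad, hE]
    · rw [star_mul, star_star, mul_assoc, ← mul_assoc (star (a n)), aa, ← mul_assoc, ad, hE]
  obtain ⟨t, ht⟩ := aw_set hAW (fun n : ℕ => E (2 * n))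
  obtain ⟨u, hu⟩ := aw_set hAW (fun n : ℕ => E (2 * n + 1))
  obtain ⟨u1, hu1⟩ := aw_set hAW (fun n : ℕ => E (4 * n + 1))
  obtain ⟨u2, hu2⟩ := aw_set hAW (fun n : ℕ => E (4 * n + 3))
  have tu : t * u = 0 := ht.orth hu (fun i => (EP _).1) (fun i j => Eo _ _ (by omega))
  have tu1 : t * u1 = 0 := ht.orth hu1 (fun i => (EP _).1) (fun i j => Eo _ _ (by omega))
  have tu2 : t * u2 = 0 := ht.orth hu2 (fun i => (EP _).1) (fun i j => Eo _ _ (by omega))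
  refine ⟨t, u, u1, u2, ⟨ht.1, hu.1, hu1.1, hu2.1, tu, ?_, ?_, ?_, ?_, ?_, ?_⟩, ?_, ?_, ?_⟩
  · exact hu1.sup_le fun i => by
      have := hu.le (2 * i)
      rwa [show 2 * (2 * i) + 1 = 4 * i + 1 by ring] at this
  · exact hu2.sup_le fun i => by
      have := hu.le (2 * i + 1)
      rwa [show 2 * (2 * i + 1) + 1 = 4 * i + 3 by ring] at this
  · exact hu1.orth hu2 (fun i => (EP _).1) (fun i j => Eo _ _ (by omega))
  · exact add_equiv hAW h2 (fun i => EP _) (fun i => EP _) (fun i j h => Eo _ _ (by omega))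
      (fun i j h => Eo _ _ (by omega)) (fun i => Eq _ _) ht hu tu
  · exact add_equiv hAW h2 (fun i => EP _) (fun i => EP _) (fun i j h => Eo _ _ (by omega))
      (fun i j h => Eo _ _ (by omega)) (fun i => Eq _ _) ht hu1 tu1
  · exact add_equiv hAW h2 (fun i => EP _) (fun i => EP _) (fun i j h => Eo _ _ (by omega))
      (fun i j h => Eo _ _ (by omega)) (fun i => Eq _ _) ht hu2 tu2
  · exact ht.sup_le fun i => Ee _
  · exact hu.sup_le fun i => Ee _
  · intro h0
    have := ht.le 0
    simp only [h0, mul_zero] at this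
    rw [hE, a0, hd.1, hd.2] at this
    exact hd0 this.symm

theorem proj_add_le {t u s : R} (h : t * u = 0) (hu : star u = u) (ht : star t = t)
    (h1 : (t + u) * s = t + u) (ht2 : t * t = t) (hu2 : u * u = u) : t * s = t ∧ u * s = u := by
  constructor
  · have := congrArg (t * ·) h1
    simpa [← mul_assoc, mul_add, ht2, h] using this
  · have := congrArg (u * ·) h1
    simpa [← mul_assoc, mul_add, hu2, orth_symm ht hu h] using this

theorem max_dbl (hAW : IsAWStarRing R) (h2 : ∀ x : R, x + x = 0 → x = 0)
    {e : R} (he : IsProjection e) :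
    ∃ t u u1 u2, Dbl t u u1 u2 ∧ t * e = t ∧ u * e = u ∧ ProjFinite (e - (t + u)) := by
  obtain ⟨S, hS1, hS2, hS3⟩ := zorn_orth
    (fun x : R × R × R × R => Dbl x.1 x.2.1 x.2.2.1 x.2.2.2 ∧ x.1 * e = x.1 ∧ x.2.1 * e = x.2.1)
    (fun x y => x.1 * y.1 = 0 ∧ x.2.1 * y.2.1 = 0 ∧ x.1 * y.2.1 = 0 ∧ x.2.1 * y.1 = 0)
  have hD : ∀ x : S, Dbl x.1.1 x.1.2.1 x.1.2.2.1 x.1.2.2.2 := fun x => (hS1 _ x.2).1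
  have hO : ∀ x y : S, x ≠ y → _ := fun x y h => hS2 _ x.2 _ y.2 (fun h' => h (Subtype.ext h'))
  obtain ⟨t, ht⟩ := aw_set hAW (fun x : S => x.1.1)
  obtain ⟨u, hu⟩ := aw_set hAW (fun x : S => x.1.2.1)
  obtain ⟨u1, hu1⟩ := aw_set hAW (fun x : S => x.1.2.2.1)
  obtain ⟨u2, hu2⟩ := aw_set hAW (fun x : S => x.1.2.2.2)
  have tu : t * u = 0 := ht.orth hu (fun x => (hD x).pu.1) (fun x y => by
    by_cases h : x = y
    · subst h; exact (hD x).tu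
    · exact (hO x y h).2.2.1)
  have sub0 : ∀ p q u' v' : R, IsProjection q → IsProjection v' → p * u' = p → q * v' = q →
      u' * v' = 0 → p * q = 0 := fun p q u' v' hq hv' h1 h3 h4 => by
    rw [← h1, ← le_symm hq.1 hv'.1 h3, mul_assoc, ← mul_assoc u', h4, zero_mul, mul_zero]
  have l1 : u1 * u = u1 := hu1.sup_le fun x => by
    have := hu.le x
    rw [← (hD x).l1, mul_assoc, this]
  have l2 : u2 * u = u2 := hu2.sup_le fun x => by
    have := hu.le x
    rw [← (hD x).l2, mul_assoc, this]
  have tu1 : t * u1 = 0 := by rw [← le_symm hu1.1.1 hu.1.1 l1, ← mul_assoc, tu, zero_mul]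
  have tu2 : t * u2 = 0 := by rw [← le_symm hu2.1.1 hu.1.1 l2, ← mul_assoc, tu, zero_mul]
  have u12 : u1 * u2 = 0 := hu1.orth hu2 (fun x => (hD x).p2.1) (fun x y => by
    by_cases h : x = y
    · subst h; exact (hD x).o
    · exact sub0 _ _ _ _ (hD y).p2 (hD y).pu (hD x).l1 (hD y).l2 (hO x y h).2.1)
  have te : t * e = t := ht.sup_le fun x => (hS1 _ x.2).2.1
  have ue : u * e = u := hu.sup_le fun x => (hS1 _ x.2).2.2
  have hDbl : Dbl t u u1 u2 := by
    refine ⟨ht.1, hu.1, hu1.1, hu2.1, tu, l1, l2, u12, ?_, ?_, ?_⟩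
    · exact add_equiv hAW h2 (fun x => (hD x).pt) (fun x => (hD x).pu)
        (fun x y h => (hO x y h).1) (fun x y h => (hO x y h).2.1) (fun x => (hD x).e0) ht hu tu
    · exact add_equiv hAW h2 (fun x => (hD x).pt) (fun x => (hD x).p1)
        (fun x y h => (hO x y h).1)
        (fun x y h => sub0 _ _ _ _ (hD y).p1 (hD y).pu (hD x).l1 (hD y).l1 (hO x y h).2.1)
        (fun x => (hD x).e1) ht hu1 tu1
    · exact add_equiv hAW h2 (fun x => (hD x).pt) (fun x => (hD x).p2)
        (fun x y h => (hO x y h).1)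
        (fun x y h => sub0 _ _ _ _ (hD y).p2 (hD y).pu (hD x).l2 (hD y).l2 (hO x y h).2.1)
        (fun x => (hD x).e2) ht hu2 tu2
  refine ⟨t, u, u1, u2, hDbl, te, ue, ?_⟩
  by_contra hinf
  have hs : IsProjection (t + u) := proj_add ht.1 hu.1 tu
  have hse : (t + u) * e = t + u := by rw [add_mul, te, ue]
  have hk : IsProjection (e - (t + u)) := proj_sub hs he hse
  obtain ⟨t', u', u1', u2', hD', te', ue', ht0⟩ := infinite_dbl hAW h2 hk hinf
  have ut : u * t = 0 := orth_symm ht.1.1 hu.1.1 tu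
  have tk : t * (e - (t + u)) = 0 := by rw [mul_sub, te, mul_add, ht.1.2, tu]; simp
  have uk : u * (e - (t + u)) = 0 := by rw [mul_sub, ue, mul_add, hu.1.2, ut]; simp
  have ke : (e - (t + u)) * e = e - (t + u) := by rw [sub_mul, he.2, hse]
  have z : ∀ p q p' : R, IsProjection p' → p * q = p → q * (e - (t + u)) = 0 →
      p' * (e - (t + u)) = p' → p * p' = 0 := fun p q p' hp' h1 h3 h4 => by
    rw [← h1, ← le_symm hp'.1 hk.1 h4, mul_assoc, ← mul_assoc q, h3, zero_mul, mul_zero]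
  have hmem : (t', u', u1', u2') ∈ S := hS3 _ ⟨hD', by rw [← te', mul_assoc, ke],
      by rw [← ue', mul_assoc, ke]⟩ (by
    intro x hx
    have hDx := hD ⟨x, hx⟩
    have xt : x.1 * t = x.1 := ht.le ⟨x, hx⟩
    have xu : x.2.1 * u = x.2.1 := hu.le ⟨x, hx⟩
    have r1 : x.1 * t' = 0 := z _ _ _ hD'.pt xt tk te'
    have r2 : x.2.1 * u' = 0 := z _ _ _ hD'.pu xu uk ue'
    have r3 : x.1 * u' = 0 := z _ _ _ hD'.pu xt tk ue'
    have r4 : x.2.1 * t' = 0 := z _ _ _ hD'.pt xu uk te'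
    exact ⟨⟨r1, r2, r3, r4⟩, orth_symm hDx.pt.1 hD'.pt.1 r1, orth_symm hDx.pu.1 hD'.pu.1 r2,
      orth_symm hDx.pu.1 hD'.pt.1 r4, orth_symm hDx.pt.1 hD'.pu.1 r3⟩)
  apply ht0
  have h3 : t' * t = t' := ht.le ⟨_, hmem⟩
  have h4 : t' * t' = 0 := z _ _ _ hD'.pt h3 tk te'
  rw [← hD'.pt.2, h4]

theorem pi_double (hAW : IsAWStarRing R) (h2 : ∀ x : R, x + x = 0 → x = 0) (hS : HasSign R)
    {e : R} (he : ProperlyInfinite e) :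
    ∃ t u, IsProjection t ∧ IsProjection u ∧ t * u = 0 ∧ t * e = t ∧ u * e = u ∧
      SubE e t ∧ SubE e u := by
  obtain ⟨heP, -, hinf⟩ := he
  obtain ⟨t, u, u1, u2, hD, te, ue, hfin⟩ := max_dbl hAW h2 heP
  obtain ⟨su, st⟩ := hD.sub hAW
  have hs : IsProjection (t + u) := proj_add hD.pt hD.pu hD.tu
  have hse : (t + u) * e = t + u := by rw [add_mul, te, ue]
  have hk : IsProjection (e - (t + u)) := proj_sub hs heP hse
  obtain ⟨h, hh, a1, a2⟩ := gc hAW h2 hS hk hs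
  have hz := central_one_sub hh
  set k := e - (t + u) with hkd
  have hek : e = k + (t + u) := by rw [hkd]; abel
  clear_value k
  set z := 1 - h with hzd
  have fk : ProjFinite (z * k) := finite_sub hAW (central_proj_mul hz hk) hk hfin
    (SubE.of_le (central_proj_mul hz hk) hk (by rw [mul_assoc, hk.2]))
  have fs : ProjFinite (z * (t + u)) := finite_sub hAW (central_proj_mul hz hs)
    (central_proj_mul hz hk) fk a2
  have zs0 : z * (t + u) = 0 := by
    have s1 := su.mul_central hz
    obtain ⟨v, hv, hv'⟩ := s1
    have hzs := central_proj_mul hz hs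
    have hzu := central_proj_mul hz hD.pu
    have hc := proj_final hAW hzs hv
    have ut := orth_symm hD.pt.1 hD.pu.1 hD.tu
    have svu : star v * (z * u) = star v := by
      have := congrArg star hv'; rwa [star_mul, hzu.1] at this
    have hus : z * u * (z * (t + u)) = z * u := by
      rw [mul_assoc, ← mul_assoc u, ← hz.2 u, mul_assoc, mul_add, ut, hD.pu.2, zero_add,
        ← mul_assoc, hz.1.2]
    have hcs : v * star v * (z * (t + u)) = v * star v := by
      rw [mul_assoc]
      nth_rewrite 1 [← svu]
      rw [mul_assoc, hus, svu]
    have := fs _ hc ⟨v, hv, rfl⟩ hcs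
    have h3 : z * (t + u) * (z * u) = z * (t + u) := by rw [← this, mul_assoc, svu]
    have h4 : z * u = z * (t + u) :=
      (le_symm hzu.1 hzs.1 hus).symm.trans h3
    have zt : z * t = 0 := by
      rw [mul_add] at h4
      exact left_eq_add.1 (h4.trans (add_comm _ _))
    obtain ⟨w, hw, hw'⟩ := (hD.e0.symm'.subE hAW hD.pt).mul_central hz
    rw [zt, zero_mul] at hw'
    rw [← hw', mul_zero] at hw
    rw [mul_add, zt, ← hw, add_zero]
  have ze : z * e = 0 := by
    by_contra hne
    apply hinf z hz hne
    rw [hek, mul_add, zs0, add_zero]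
    exact fk
  have heh : h * e = e := by
    rw [hzd, sub_mul, one_mul] at ze
    exact (sub_eq_zero.1 ze).symm
  have hks : k * e = k := by
    rw [hkd, sub_mul, hse, heP.2]
  have zk : h * k = k := by
    rw [← le_symm hk.1 heP.1 hks, ← mul_assoc, heh]
  have hsP := central_proj_mul hh hs
  have k1 : SubE k (t + u) := by
    rw [zk] at a1
    exact a1.trans (SubE.of_le hsP hs (by rw [mul_assoc, hs.2]))
  have es : SubE e (t + u) := by
    rw [hek, add_comm t u]
    exact SubE.add hD.pu hD.pt (k1.trans su) (by rw [add_comm u t]; exact st)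
      (orth_symm hD.pt.1 hD.pu.1 hD.tu)
  exact ⟨t, u, hD.pt, hD.pu, hD.tu, te, ue, es.trans st, es.trans su⟩

theorem main_sub (hAW : IsAWStarRing R) (h2 : ∀ x : R, x + x = 0 → x = 0) (hS : HasSign R)
    {e f j : R} (he : ProperlyInfinite e) (hf : IsProjection f) (hj : IsJoinProj e f j)
    (h : SubE f e) : ProjEquiv j e := by
  obtain ⟨t, u, pt, pu, tu, te, ue, et, eu⟩ := pi_double hAW h2 hS he
  refine schroeder hAW he.1 hj.1 hj.2.1 ?_
  have h1 : SubE (j - e) u := ((parallelogram hAW hS he.1 hf hj).trans h).trans eu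
  have h3 := SubE.add pt pu et h1 tu
  rw [add_sub_cancel] at h3
  exact h3.trans (SubE.of_le (proj_add pt pu tu) he.1 (by rw [add_mul, te, ue]))

theorem main_all (hAW : IsAWStarRing R) (h2 : ∀ x : R, x + x = 0 → x = 0) (hS : HasSign R)
    {e f j ce cf : R} (he : ProperlyInfinite e) (hf : IsProjection f) (hj : IsJoinProj e f j)
    (hce : IsCentralCover e ce) (hcf : IsCentralCover f cf) :
    (ProjSubEquiv f e → ProjEquiv j e) ∧
    (ProjFinite f → ProjLE cf ce → ProjEquiv j e) := by
  refine ⟨fun h => main_sub hAW h2 hS he hf hj (h.subE hAW he.1), fun hfin hle => ?_⟩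
  apply main_sub hAW h2 hS he hf hj
  obtain ⟨h, hh, a1, a2⟩ := gc hAW h2 hS hf he.1
  have hz := central_one_sub hh
  have hze := central_proj_mul hz he.1
  have hzf := central_proj_mul hz hf
  have ze : (1 - h) * e = 0 := by
    by_contra hne
    apply he.2.2 _ hz hne
    exact finite_sub hAW hze hf hfin (a2.trans (SubE.of_le hzf hf (by rw [mul_assoc, hf.2])))
  have heh : h * e = e := by
    rw [sub_mul, one_mul] at ze
    exact (sub_eq_zero.1 ze).symm
  have c1 : ce * h = ce := hce.2.2 h hh (by change e * h = e; rw [← hh.2, heh])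
  have c2 : cf * ce = cf := hle
  have c3 : f * cf = f := hcf.2.1
  have c4 : h * f = f := by
    rw [hh.2, ← c3, mul_assoc, ← c2, mul_assoc, c1]
  rwa [c4, heh] at a1

end Helpers3

/-- Let `e` be properly infinite and `f` a projection, with join `e ∨ f = j`.
(i) If `f ≼ e` then `e ∨ f ∼ e`. (ii) If `f` is finite and `c(f) ≤ c(e)`, then
`e ∨ f ∼ e`. -/
theorem join_equiv_of_properlyInfinite {A : Type u} [NormedRing A] [StarRing A]
    [CStarRing A] [NormedAlgebra ℂ A] [StarModule ℂ A] [CompleteSpace A]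
    (hAW : IsAWStarRing A) (e f j ce cf : A)
    (he : ProperlyInfinite e) (hf : IsProjection f)
    (hj : IsJoinProj e f j)
    (hce : IsCentralCover e ce) (hcf : IsCentralCover f cf) :
    (ProjSubEquiv f e → ProjEquiv j e) ∧
    (ProjFinite f → ProjLE cf ce → ProjEquiv j e) := by

  letI : CStarAlgebra A := {}
  have hS : HasSign A := hasSign_cstar
  refine main_all hAW (fun x hx => ?_) hS he hf hj hce hcf
  have h3 : (2 : ℂ) • x = 0 := by rw [two_smul, hx]
  exact (smul_eq_zero.1 h3).resolve_left two_ne_zero
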